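/- For every γ ≥ 0 there exists g₀ such that for all g ≥ g₀ the following holds: if T is a (3,γ)-hyperelliptic numerical semigroup of genus g with u_1 := u_1(T) = g − γ + 1 + ⌊((g−γ) mod 3)/2⌋ and T_{(u_1 mod 3)} = {u_1 + 3k : k ∈ ℕ} ∩ {1,…,2g}, then for every (3,γ)-hyperelliptic numerical semigroup S of genus g one has #S_{(u_1(S) mod 3)} ≤ #T_{(u_1 mod 3)}. -/

import Mathlib

/-- A numerical semigroup: a subset of ℕ containing 0, closed under addition,
with finite complement. -/
def IsNumericalSemigroup (S : Set ℕ) : Prop :=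
  0 ∈ S ∧ (∀ a ∈ S, ∀ b ∈ S, a + b ∈ S) ∧ Sᶜ.Finite

/-- The genus of a numerical semigroup: the number of gaps. -/
noncomputable def genus (S : Set ℕ) : ℕ := Sᶜ.ncard

/-- The weight of a numerical semigroup of genus g: writing the gaps as
ℓ_1 < ⋯ < ℓ_g, it is Σ (ℓ_i − i) = (Σ ℓ_i) − g(g+1)/2. -/
noncomputable def weight (S : Set ℕ) : ℤ :=
  (∑ᶠ ℓ ∈ Sᶜ, (ℓ : ℤ)) - (genus S * (genus S + 1)) / 2

/-- S is (N,γ)-hyperelliptic: the γ smallest positive elements of S are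
n_1 < ⋯ < n_γ, all multiples of N with n_γ = 2γN, and (2γ+1)N ∈ S. -/
def IsNgammaHyperelliptic (N γ : ℕ) (S : Set ℕ) : Prop :=
  IsNumericalSemigroup S ∧
  {s ∈ S | 0 < s ∧ s ≤ 2 * γ * N}.ncard = γ ∧
  (∀ s ∈ S, 0 < s → s ≤ 2 * γ * N → N ∣ s) ∧
  2 * γ * N ∈ S ∧
  (2 * γ + 1) * N ∈ S

/-- u₁(S): the smallest positive element of S not divisible by 3. -/
noncomputable def u1 (S : Set ℕ) : ℕ := sInf {s ∈ S | ¬ 3 ∣ s}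

/-- χ(S) = u₁(S) − (g − 3γ + 1 + ⌊(g mod 3)/2⌋), computed in ℤ. -/
noncomputable def chi (γ g : ℕ) (S : Set ℕ) : ℤ :=
  (u1 S : ℤ) - ((g : ℤ) - 3 * γ + 1 + ((g : ℤ) % 3) / 2)

/-- S_i: the elements of S ∩ {1,…,2g} congruent to i modulo 3. -/
def resSet (g i : ℕ) (S : Set ℕ) : Set ℕ :=
  {s ∈ S | 1 ≤ s ∧ s ≤ 2 * g ∧ s % 3 = i}

/-- The inflection Ĩ_S = Σ_{s ∈ S ∩ {1,…,2g}} s. -/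
noncomputable def inflection (g : ℕ) (S : Set ℕ) : ℕ :=
  ∑ᶠ s ∈ {s ∈ S | 1 ≤ s ∧ s ≤ 2 * g}, s

open Classical in
/-- Numbers below `n` congruent to `i` modulo 3. -/
theorem card_filter_range_mod_three (n i : ℕ) (hi : i < 3) :
    ((Finset.range n).filter (fun x => x % 3 = i)).card = (n + 2 - i) / 3 := by
  induction n with
  | zero => simp; omega
  | succ n ih =>
    rw [Finset.range_add_one, Finset.filter_insert]
    split_ifs with h
    · rw [Finset.card_insert_of_notMem (by simp), ih]; omega
    · rw [ih]; omega

open Classical in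
/-- If `x` is a gap of an additively closed set, at least half of `{0, …, x}` are gaps. -/
theorem succ_le_two_mul_card_gaps {A : Set ℕ} (hadd : ∀ a ∈ A, ∀ b ∈ A, a + b ∈ A)
    {x : ℕ} (hx : x ∉ A) :
    x + 1 ≤ 2 * ((Finset.range (x + 1)).filter (fun y => y ∉ A)).card := by
  have hsplit := Finset.card_filter_add_card_filter_not (s := Finset.range (x + 1))
    (fun y => y ∈ A)
  have hle : ((Finset.range (x + 1)).filter (fun y => y ∈ A)).card ≤
      ((Finset.range (x + 1)).filter (fun y => y ∉ A)).card := by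
    refine Finset.card_le_card_of_injOn (fun a => x - a) ?_ ?_
    · intro a ha
      simp only [Finset.coe_filter, Finset.mem_range, Set.mem_ofPred_eq] at ha ⊢
      refine ⟨by omega, fun h => hx ?_⟩
      have := hadd _ ha.2 _ h
      rwa [Nat.add_sub_cancel' (by omega)] at this
    · intro a ha b hb hab
      simp only [Finset.coe_filter, Finset.mem_range, Set.mem_ofPred_eq] at ha hb hab
      omega
  rw [Finset.card_range] at hsplit
  omega

open Classical in
/-- Every gap of a numerical semigroup is smaller than twice the genus. -/
theorem IsNumericalSemigroup.lt_two_mul_genus {S : Set ℕ} (hS : IsNumericalSemigroup S)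
    {x : ℕ} (hx : x ∉ S) : x < 2 * genus S := by
  have h := succ_le_two_mul_card_gaps hS.2.1 hx
  have hle : ((Finset.range (x + 1)).filter (fun y => y ∉ S)).card ≤ genus S := by
    rw [genus, ← Set.ncard_coe_finset]
    refine Set.ncard_le_ncard (fun y hy => ?_) hS.2.2
    simp only [Finset.coe_filter, Set.mem_ofPred_eq] at hy
    exact hy.2
  omega

open Classical in
/-- The multiples of 3 missing from `S` in `[0, 6γ]` are `γ` in number. -/
theorem IsNgammaHyperelliptic.card_gaps_range {γ : ℕ} {S : Set ℕ}
    (hS : IsNgammaHyperelliptic 3 γ S) :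
    ((Finset.range (2 * γ + 1)).filter (fun y => 3 * y ∉ S)).card = γ := by
  obtain ⟨⟨h0, -, -⟩, hcard, hdvd, -, -⟩ := hS
  have hsplit := Finset.card_filter_add_card_filter_not (s := Finset.range (2 * γ + 1))
    (fun y => 3 * y ∈ S)
  have himage : (fun y => 3 * y) ''
      ((Finset.range (2 * γ + 1)).filter (fun y => 3 * y ∈ S) : Set ℕ) = insert 0 {s ∈ S | 0 < s ∧ s ≤ 2 * γ * 3} := by
    ext s
    simp only [Finset.coe_filter, Set.mem_image, Set.mem_ofPred_eq, Finset.mem_range,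
      Set.mem_insert_iff]
    constructor
    · rintro ⟨y, ⟨hy, hyS⟩, rfl⟩
      rcases Nat.eq_zero_or_pos y with rfl | hpos
      · exact Or.inl rfl
      · exact Or.inr ⟨hyS, by omega, by omega⟩
    · rintro (rfl | ⟨hs, hpos, hle⟩)
      · exact ⟨0, ⟨by omega, h0⟩, rfl⟩
      · obtain ⟨y, rfl⟩ := hdvd s hs hpos hle
        exact ⟨y, ⟨by omega, hs⟩, rfl⟩
  have hfin : {s ∈ S | 0 < s ∧ s ≤ 2 * γ * 3}.Finite :=
    (Set.finite_Iic (2 * γ * 3)).subset fun s hs => hs.2.2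
  have hnum : ((Finset.range (2 * γ + 1)).filter (fun y => 3 * y ∈ S)).card = γ + 1 := by
    rw [← Set.ncard_coe_finset,
      ← Set.ncard_image_of_injective _ (fun a b (h : 3 * a = 3 * b) => by omega), himage,
      Set.ncard_insert_of_notMem (fun h => absurd h.2.1 (by omega)) hfin, hcard]
  rw [hnum, Finset.card_range] at hsplit
  omega

open Classical in
/-- A `(3,γ)`-hyperelliptic semigroup contains every multiple of 3 from `6γ` on. -/
theorem IsNgammaHyperelliptic.three_mul_mem {γ : ℕ} {S : Set ℕ}
    (hS : IsNgammaHyperelliptic 3 γ S) (m : ℕ) (hm : 2 * γ ≤ m) : 3 * m ∈ S := by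
  induction m using Nat.strong_induction_on with
  | _ m ih =>
    by_contra hmS
    have hgaps := succ_le_two_mul_card_gaps (A := {y | 3 * y ∈ S})
      (fun a ha b hb => by
        simp only [Set.mem_ofPred_eq] at ha hb ⊢
        rw [mul_add]
        exact hS.1.2.1 _ ha _ hb) hmS
    have hle : ((Finset.range (m + 1)).filter (fun y => y ∉ {y | 3 * y ∈ S})).card ≤ γ + 1 := by
      rw [← hS.card_gaps_range]
      refine le_trans (Finset.card_le_card ?_) (Finset.card_insert_le m _)
      intro y hy
      simp only [Finset.mem_filter, Finset.mem_range, Set.mem_ofPred_eq, Finset.mem_insert] at hy ⊢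
      by_cases hym : y = m
      · exact Or.inl hym
      · refine Or.inr ⟨?_, hy.2⟩
        by_contra hlt
        exact hy.2 (ih y (by omega) (by omega))
    obtain ⟨-, -, -, h1, h2⟩ := hS
    have : m = 2 * γ ∨ m = 2 * γ + 1 := by omega
    rcases this with rfl | rfl
    · exact hmS (by rwa [mul_comm] at h1)
    · exact hmS (by rwa [mul_comm] at h2)

/-- `u1 S` is an element of `S` prime to 3. -/
theorem IsNumericalSemigroup.u1_mem {S : Set ℕ} (hS : IsNumericalSemigroup S) :
    u1 S ∈ S ∧ u1 S % 3 ≠ 0 := by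
  have hne : {s ∈ S | ¬ 3 ∣ s}.Nonempty := by
    refine ⟨3 * genus S + 1, ?_, by omega⟩
    by_contra h
    have := hS.lt_two_mul_genus h
    omega
  have h := Nat.sInf_mem hne
  exact ⟨h.1, fun h0 => h.2 (Nat.dvd_of_mod_eq_zero h0)⟩

open Classical in
/-- The gaps of `S` in the residue class `i` modulo 3. -/
noncomputable def gapsMod (S : Set ℕ) (i : ℕ) : Finset ℕ :=
  (Finset.range (2 * genus S + 1)).filter (fun x => x % 3 = i ∧ x ∉ S)

theorem IsNumericalSemigroup.mem_gapsMod {S : Set ℕ} (hS : IsNumericalSemigroup S) {i x : ℕ} :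
    x ∈ gapsMod S i ↔ x % 3 = i ∧ x ∉ S := by
  simp only [gapsMod, Finset.mem_filter, Finset.mem_range, and_iff_right_iff_imp]
  intro h
  have := hS.lt_two_mul_genus h.2
  omega

open Classical in
theorem IsNumericalSemigroup.genus_le_sum_card_gapsMod {S : Set ℕ}
    (hS : IsNumericalSemigroup S) :
    genus S ≤ (gapsMod S 0).card + (gapsMod S 1).card + (gapsMod S 2).card := by
  have hsub : Sᶜ ⊆ ((gapsMod S 0 ∪ gapsMod S 1 ∪ gapsMod S 2 : Finset ℕ) : Set ℕ) := by
    intro x hx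
    simp only [Finset.mem_coe, Finset.mem_union, hS.mem_gapsMod]
    have hx' : x ∉ S := hx
    have : x % 3 = 0 ∨ x % 3 = 1 ∨ x % 3 = 2 := by omega
    tauto
  have h1 := Set.ncard_le_ncard hsub (Finset.finite_toSet _)
  rw [Set.ncard_coe_finset] at h1
  have h2 := Finset.card_union_le (gapsMod S 0 ∪ gapsMod S 1) (gapsMod S 2)
  have h3 := Finset.card_union_le (gapsMod S 0) (gapsMod S 1)
  rw [genus]
  omega

open Classical in
theorem IsNgammaHyperelliptic.card_gapsMod_zero_le {γ : ℕ} {S : Set ℕ}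
    (hS : IsNgammaHyperelliptic 3 γ S) : (gapsMod S 0).card ≤ γ := by
  rw [← hS.card_gaps_range]
  refine Finset.card_le_card_of_injOn (fun x => x / 3) ?_ ?_
  · intro x hx
    obtain ⟨h0, hxS⟩ := hS.1.mem_gapsMod.1 hx
    have hx3 : 3 * (x / 3) = x := by omega
    simp only [Finset.coe_filter, Finset.mem_range, Set.mem_ofPred_eq, hx3]
    refine ⟨?_, hxS⟩
    by_contra hlt
    exact hxS (hx3 ▸ hS.three_mul_mem (x / 3) (by omega))
  · intro x hx y hy hxy
    have h1 := (hS.1.mem_gapsMod.1 hx).1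
    have h2 := (hS.1.mem_gapsMod.1 hy).1
    simp only at hxy
    omega

/-- All numbers below `u1` in the residue class of `u1` are gaps. -/
theorem IsNumericalSemigroup.card_below_u1_le {S : Set ℕ} (hS : IsNumericalSemigroup S) :
    ((Finset.range (u1 S)).filter (fun x => x % 3 = u1 S % 3)).card ≤
      (gapsMod S (u1 S % 3)).card := by
  refine Finset.card_le_card fun x hx => ?_
  simp only [Finset.mem_filter, Finset.mem_range] at hx
  refine hS.mem_gapsMod.2 ⟨hx.2, fun hxS => ?_⟩
  have h3 : ¬ 3 ∣ x := fun h => hS.u1_mem.2 (by omega)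
  have : u1 S ≤ x := Nat.sInf_le ⟨hxS, h3⟩
  omega

open Classical in
/-- Translation by `u1` bounds the gaps of the class of `2 * u1` by those of the class of `u1`. -/
theorem IsNumericalSemigroup.card_gapsMod_two_mul_u1_le {S : Set ℕ}
    (hS : IsNumericalSemigroup S) :
    (gapsMod S (2 * u1 S % 3)).card ≤
      ((Finset.range (u1 S)).filter (fun x => x % 3 = 2 * u1 S % 3)).card +
        (gapsMod S (u1 S % 3)).card := by
  have hsub : gapsMod S (2 * u1 S % 3) ⊆
      (Finset.range (u1 S)).filter (fun x => x % 3 = 2 * u1 S % 3) ∪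
        (gapsMod S (u1 S % 3)).image (fun y => u1 S + y) := by
    intro x hx
    rw [hS.mem_gapsMod] at hx
    simp only [Finset.mem_union, Finset.mem_filter, Finset.mem_range, Finset.mem_image]
    by_cases hlt : x < u1 S
    · exact Or.inl ⟨hlt, hx.1⟩
    · refine Or.inr ⟨x - u1 S, hS.mem_gapsMod.2 ⟨by omega, fun h => hx.2 ?_⟩, by omega⟩
      have := hS.2.1 _ hS.u1_mem.1 _ h
      rwa [Nat.add_sub_cancel' (by omega)] at this
  have h1 := Finset.card_le_card hsub
  have h2 := Finset.card_union_le
    ((Finset.range (u1 S)).filter (fun x => x % 3 = 2 * u1 S % 3))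
    ((gapsMod S (u1 S % 3)).image (fun y => u1 S + y))
  have h3 := Finset.card_image_le (s := gapsMod S (u1 S % 3)) (f := fun y => u1 S + y)
  omega

open Classical in
theorem ncard_resSet_add_card_gapsMod (S : Set ℕ) {i : ℕ} (hi0 : i ≠ 0) (hi : i < 3) :
    (resSet (genus S) i S).ncard + (gapsMod S i).card = (2 * genus S + 3 - i) / 3 := by
  have hres : resSet (genus S) i S =
      (((Finset.range (2 * genus S + 1)).filter (fun x => x % 3 = i)).filter
        (fun x => x ∈ S) : Finset ℕ) := by
    ext x
    simp only [resSet, Finset.coe_filter, Finset.mem_filter, Finset.mem_range, Set.mem_ofPred_eq]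
    constructor
    · rintro ⟨h1, h2, h3, h4⟩
      exact ⟨⟨by omega, h4⟩, h1⟩
    · rintro ⟨⟨h1, h2⟩, h3⟩
      exact ⟨h3, by omega, by omega, h2⟩
  have hgap : gapsMod S i =
      ((Finset.range (2 * genus S + 1)).filter (fun x => x % 3 = i)).filter
        (fun x => ¬ x ∈ S) := by
    rw [gapsMod, Finset.filter_filter]
  rw [hres, Set.ncard_coe_finset, hgap, Finset.card_filter_add_card_filter_not,
    card_filter_range_mod_three _ _ hi]

open Classical in
/-- The number of terms of an arithmetic progression of difference 3 in `[1, 2g]`. -/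
theorem le_ncard_progression (g u : ℕ) (hu : u % 3 ≠ 0) :
    (2 * g + 3 - u % 3) / 3 - (u + 2 - u % 3) / 3 ≤
      {s : ℕ | (∃ k : ℕ, s = u + 3 * k) ∧ 1 ≤ s ∧ s ≤ 2 * g}.ncard := by
  have hset : {s : ℕ | (∃ k : ℕ, s = u + 3 * k) ∧ 1 ≤ s ∧ s ≤ 2 * g} =
      ((Finset.range (2 * g + 1)).filter (fun x => x % 3 = u % 3) \
        (Finset.range u).filter (fun x => x % 3 = u % 3) : Finset ℕ) := by
    ext x
    simp only [Finset.coe_sdiff, Finset.coe_filter, Finset.mem_range, Set.mem_sdiff,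
      Set.mem_ofPred_eq]
    constructor
    · rintro ⟨⟨k, rfl⟩, h1, h2⟩
      omega
    · rintro ⟨⟨h1, h2⟩, h3⟩
      exact ⟨⟨(x - u) / 3, by omega⟩, by omega, by omega⟩
  have h := Finset.le_card_sdiff ((Finset.range u).filter (fun x => x % 3 = u % 3))
    ((Finset.range (2 * g + 1)).filter (fun x => x % 3 = u % 3))
  rw [card_filter_range_mod_three _ _ (Nat.mod_lt _ (by omega)),
    card_filter_range_mod_three _ _ (Nat.mod_lt _ (by omega))] at h
  rw [hset, Set.ncard_coe_finset]
  exact h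

/-- when u₁(T) = g − γ + 1 + ⌊((g−γ) mod 3)/2⌋ and T_{(u₁ mod 3)} is the
full arithmetic progression, #T_{(u₁ mod 3)} is maximal among all
(3,γ)-hyperelliptic semigroups of genus g. -/
theorem stmt9 (γ : ℕ) :
    ∃ g₀ : ℕ, ∀ g ≥ g₀, ∀ T : Set ℕ,
      IsNgammaHyperelliptic 3 γ T → genus T = g →
      (u1 T : ℤ) = (g : ℤ) - γ + 1 + (((g : ℤ) - γ) % 3) / 2 →
      resSet g (u1 T % 3) T =
        {s : ℕ | (∃ k : ℕ, s = u1 T + 3 * k) ∧ 1 ≤ s ∧ s ≤ 2 * g} →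
      ∀ S : Set ℕ, IsNgammaHyperelliptic 3 γ S → genus S = g →
        (resSet g (u1 S % 3) S).ncard ≤ (resSet g (u1 T % 3) T).ncard := by
  refine ⟨γ + 2, fun g hg T hT _ hu hprog S hS hgS => ?_⟩
  have hTcard := le_ncard_progression g (u1 T) hT.1.u1_mem.2
  rw [hprog]
  subst hgS
  have hSmod := hS.1.u1_mem.2
  have hScard := ncard_resSet_add_card_gapsMod S hSmod (Nat.mod_lt _ (by omega))
  have hsum := hS.1.genus_le_sum_card_gapsMod
  have hzero := hS.card_gapsMod_zero_le
  have hbelow := hS.1.card_below_u1_le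
  have htrans := hS.1.card_gapsMod_two_mul_u1_le
  rw [card_filter_range_mod_three _ _ (Nat.mod_lt _ (by omega))] at hbelow htrans
  obtain ⟨q, hq⟩ : ∃ q, (genus S = γ + 3 * q ∧ u1 T = 3 * q + 1) ∨
      (genus S = γ + 3 * q + 1 ∧ u1 T = 3 * q + 2) ∨
      (genus S = γ + 3 * q + 2 ∧ u1 T = 3 * q + 4) := ⟨(genus S - γ) / 3, by omega⟩
  have hTmod : u1 T % 3 = 1 ∨ u1 T % 3 = 2 := by omega
  have hcases : u1 S % 3 = 1 ∧ 2 * u1 S % 3 = 2 ∨ u1 S % 3 = 2 ∧ 2 * u1 S % 3 = 1 := by omega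
  rcases hcases with ⟨h, h'⟩ | ⟨h, h'⟩ <;> rw [h, h'] at htrans <;>
    rw [h] at hScard hbelow ⊢ <;> rcases hTmod with hT' | hT' <;> rw [hT'] at hTcard <;>
    omega
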